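/- arXiv:2212.06646 — 4 statements merged into one kernel-verified Lean document; each statement's English description precedes it below -/
import Mathlib

section
/- The profit function f(m) = σ(m) − δ(m) of the profit maximization problem is DR-submodular on (S → ℕ): for all marketing strategies m ≤ m′ (coordinatewise) and all e ∈ S, f(m + χ_e) − f(m) ≥ f(m′ + χ_e) − f(m′). -/
open Finset

/-- Activation probability of target `t` under strategy `m`:
`p_t(m) = 1 - ∏_{s ∈ Γ(t)} ∏_{i=1}^{m(s)} (1 - p_s^i)`. -/
noncomputable def activationProb {S T : Type*} (Γ : T → Finset S) (p : S → ℕ → ℝ)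
    (t : T) (m : S → ℕ) : ℝ :=
  1 - ∏ s ∈ Γ t, ∏ i ∈ Finset.Icc 1 (m s), (1 - p s i)

/-- Expected influence `σ(m) = ∑_{t ∈ T} p_t(m)`. -/
noncomputable def expectedInfluence {S T : Type*} [Fintype T] (Γ : T → Finset S)
    (p : S → ℕ → ℝ) (m : S → ℕ) : ℝ :=
  ∑ t : T, activationProb Γ p t m

/-- Marketing cost `δ(m) = ∑_{s ∈ S} m(s) · δ_s`. -/
noncomputable def marketingCost {S : Type*} [Fintype S] (δ : S → ℝ) (m : S → ℕ) : ℝ :=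
  ∑ s : S, (m s : ℝ) * δ s

/-- Profit `f(m) = σ(m) - δ(m)`. -/
noncomputable def profit {S T : Type*} [Fintype S] [Fintype T] (Γ : T → Finset S)
    (p : S → ℕ → ℝ) (δ : S → ℝ) (m : S → ℕ) : ℝ :=
  expectedInfluence Γ p m - marketingCost δ m

/-- Probability that target `t` is not activated under strategy `m`. -/
noncomputable def inactivationProb {S T : Type*} (Γ : T → Finset S) (p : S → ℕ → ℝ)
    (t : T) (m : S → ℕ) : ℝ :=
  ∏ s ∈ Γ t, ∏ i ∈ Finset.Icc 1 (m s), (1 - p s i)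

lemma inactivationProb_nonneg {S T : Type*} (Γ : T → Finset S) {p : S → ℕ → ℝ}
    (hp1 : ∀ s i, p s i ≤ 1) (t : T) (m : S → ℕ) : 0 ≤ inactivationProb Γ p t m :=
  prod_nonneg fun s _ => prod_nonneg fun i _ => sub_nonneg.2 (hp1 s i)

lemma inactivationProb_antitone {S T : Type*} (Γ : T → Finset S) {p : S → ℕ → ℝ}
    (hp0 : ∀ s i, 0 ≤ p s i) (hp1 : ∀ s i, p s i ≤ 1) (t : T) :
    Antitone (inactivationProb Γ p t) := fun _ _ h =>
  prod_le_prod (fun s _ => prod_nonneg fun i _ => sub_nonneg.2 (hp1 s i)) fun s _ =>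
    prod_le_prod_of_subset_of_le_one (Icc_subset_Icc_right (h s))
      (fun i _ => sub_nonneg.2 (hp1 s i)) fun i _ _ => sub_le_self _ (hp0 s i)

lemma inactivationProb_add_single {S T : Type*} [DecidableEq S] (Γ : T → Finset S)
    (p : S → ℕ → ℝ) (t : T) (m : S → ℕ) (e : S) :
    inactivationProb Γ p t (m + Pi.single e 1) =
      inactivationProb Γ p t m * if e ∈ Γ t then 1 - p e (m e + 1) else 1 := by
  have hfactor : ∀ s, ∏ i ∈ Icc 1 ((m + Pi.single e 1 : S → ℕ) s), (1 - p s i) =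
      (∏ i ∈ Icc 1 (m s), (1 - p s i)) * if e = s then 1 - p s (m s + 1) else 1 := by
    intro s
    obtain rfl | h := eq_or_ne e s
    · simp [prod_Icc_succ_top]
    · simp [h, h.symm]
  simp only [inactivationProb, hfactor, prod_mul_distrib, prod_ite_eq]

lemma activationProb_marginal {S T : Type*} [DecidableEq S] (Γ : T → Finset S)
    (p : S → ℕ → ℝ) (t : T) (m : S → ℕ) (e : S) :
    activationProb Γ p t (m + Pi.single e 1) - activationProb Γ p t m =
      if e ∈ Γ t then inactivationProb Γ p t m * p e (m e + 1) else 0 := by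
  change 1 - inactivationProb Γ p t (m + Pi.single e 1) - (1 - inactivationProb Γ p t m) = _
  rw [inactivationProb_add_single]
  split_ifs <;> ring

lemma marketingCost_add {S : Type*} [Fintype S] (δ : S → ℝ) (m n : S → ℕ) :
    marketingCost δ (m + n) = marketingCost δ m + marketingCost δ n := by
  simp [marketingCost, add_mul, sum_add_distrib]

/-- The profit function of the profit maximization problem is DR-submodular on `S → ℕ`. -/
theorem profit_DRSubmodular {S T : Type*} [Fintype S] [Fintype T] [DecidableEq S]
    (Γ : T → Finset S) (p : S → ℕ → ℝ) (δ : S → ℝ)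
    (hp0 : ∀ s i, 0 ≤ p s i) (hp1 : ∀ s i, p s i ≤ 1)
    (hpmono : ∀ s i j, 1 ≤ j → j ≤ i → p s i ≤ p s j)
    (hδ : ∀ s, 0 ≤ δ s) :
    ∀ m m' : S → ℕ, m ≤ m' → ∀ e : S,
      profit Γ p δ (m + Pi.single e 1) - profit Γ p δ m ≥
        profit Γ p δ (m' + Pi.single e 1) - profit Γ p δ m' := by
  intro m m' h e
  have hσ : expectedInfluence Γ p (m' + Pi.single e 1) - expectedInfluence Γ p m' ≤
      expectedInfluence Γ p (m + Pi.single e 1) - expectedInfluence Γ p m := by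
    simp only [expectedInfluence, ← sum_sub_distrib, activationProb_marginal]
    refine sum_le_sum fun t _ => ?_
    split_ifs
    · exact mul_le_mul (inactivationProb_antitone Γ hp0 hp1 t h)
        (hpmono e _ _ (Nat.le_add_left 1 _) (Nat.add_le_add_right (h e) 1)) (hp0 _ _)
        (inactivationProb_nonneg Γ hp1 t m)
    · exact le_rfl
  simp only [profit, marketingCost_add]
  linarith
end

section
/- The expected influence function σ(m) is DR-submodular on (S → ℕ): for all m ≤ m′ (coordinatewise) and all e ∈ S, σ(m + χ_e) − σ(m) ≥ σ(m′ + χ_e) − σ(m′). -/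
open Finset

/-- The marginal gain of one more trial of `e` for the activation probability of `t`. -/
lemma activationProb_add_single_sub {S T : Type*} [DecidableEq S] (Γ : T → Finset S)
    (p : S → ℕ → ℝ) (t : T) (m : S → ℕ) (e : S) :
    activationProb Γ p t (m + Pi.single e 1) - activationProb Γ p t m =
      if e ∈ Γ t then p e (m e + 1) * ∏ s ∈ Γ t, ∏ i ∈ Finset.Icc 1 (m s), (1 - p s i)
      else 0 := by
  have hrest : ∀ A : Finset S, e ∉ A →
      ∏ s ∈ A, ∏ i ∈ Finset.Icc 1 ((m + Pi.single e 1 : S → ℕ) s), (1 - p s i) =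
        ∏ s ∈ A, ∏ i ∈ Finset.Icc 1 (m s), (1 - p s i) := by
    intro A hA
    refine Finset.prod_congr rfl fun s hs => ?_
    have hse : s ≠ e := fun h => hA (h ▸ hs)
    simp [hse]
  unfold activationProb
  split_ifs with he
  · rw [← Finset.mul_prod_erase _ _ he, ← Finset.mul_prod_erase _ _ he,
      hrest _ (Finset.notMem_erase e _), Pi.add_apply, Pi.single_eq_same,
      Finset.prod_Icc_succ_top (Nat.le_add_left 1 (m e))]
    ring
  · rw [hrest _ he, sub_self]

/-- The probability that no trial activates a target is antitone in the strategy. -/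
lemma prod_prod_one_sub_le_of_le {S : Type*} (A : Finset S) (p : S → ℕ → ℝ)
    (hp0 : ∀ s i, 0 ≤ p s i) (hp1 : ∀ s i, p s i ≤ 1) {m m' : S → ℕ} (h : m ≤ m') :
    ∏ s ∈ A, ∏ i ∈ Finset.Icc 1 (m' s), (1 - p s i) ≤
      ∏ s ∈ A, ∏ i ∈ Finset.Icc 1 (m s), (1 - p s i) := by
  have hnonneg : ∀ s i, 0 ≤ 1 - p s i := fun s i => sub_nonneg.2 (hp1 s i)
  refine Finset.prod_le_prod (fun s _ => Finset.prod_nonneg fun i _ => hnonneg s i)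
    fun s _ => ?_
  rw [← Finset.prod_sdiff (Finset.Icc_subset_Icc_right (h s))]
  exact mul_le_of_le_one_left (Finset.prod_nonneg fun i _ => hnonneg s i)
    (Finset.prod_le_one (fun i _ => hnonneg s i) fun i _ => sub_le_self _ (hp0 s i))

/-- The expected influence function `σ` is DR-submodular on `S → ℕ`. -/
theorem expectedInfluence_DRSubmodular {S T : Type*} [Fintype S] [Fintype T] [DecidableEq S]
    (Γ : T → Finset S) (p : S → ℕ → ℝ)
    (hp0 : ∀ s i, 0 ≤ p s i) (hp1 : ∀ s i, p s i ≤ 1)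
    (hpmono : ∀ s i j, 1 ≤ j → j ≤ i → p s i ≤ p s j) :
    ∀ m m' : S → ℕ, m ≤ m' → ∀ e : S,
      expectedInfluence Γ p (m + Pi.single e 1) - expectedInfluence Γ p m ≥
        expectedInfluence Γ p (m' + Pi.single e 1) - expectedInfluence Γ p m' := by
  intro m m' h e
  simp only [expectedInfluence, ge_iff_le, ← Finset.sum_sub_distrib,
    activationProb_add_single_sub]
  refine Finset.sum_le_sum fun t _ => ?_
  split_ifs
  · exact mul_le_mul
      (hpmono e _ _ (Nat.le_add_left 1 (m e)) (Nat.add_le_add_right (h e) 1))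
      (prod_prod_one_sub_le_of_le (Γ t) p hp0 hp1 h)
      (Finset.prod_nonneg fun s _ => Finset.prod_nonneg fun i _ => sub_nonneg.2 (hp1 s i))
      (hp0 e _)
  · exact le_rfl
end

section
/- Let f : (E → ℤ) → ℝ be DR-submodular, let e ∈ E, let y : E → ℤ, and let p, q be integers with 1 ≤ p ≤ q. If f(−χ_e | y − (q−1)·χ_e) ≥ 0, then 0 ≤ f(−p·χ_e | y) ≤ f(−q·χ_e | y). -/
/-- A function `f : (E → ℤ) → ℝ` is DR-submodular if for all `x ≤ y` (coordinatewise) and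
every coordinate `e`, `f(x + χ_e) - f(x) ≥ f(y + χ_e) - f(y)`. -/
def DRSubmodular {E : Type*} [Fintype E] [DecidableEq E] (f : (E → ℤ) → ℝ) : Prop :=
  ∀ x y : E → ℤ, x ≤ y → ∀ e : E,
    f (x + Pi.single e 1) - f x ≥ f (y + Pi.single e 1) - f y

/-- Marginal value `f(z | x) := f(x + z) - f(x)`. -/
def marginal {E : Type*} (f : (E → ℤ) → ℝ) (z x : E → ℤ) : ℝ := f (x + z) - f x

/-- If `f` does not increase in direction `e` at the point `x`, then `f` is antitone along the ray
`x + n • χ_e`. -/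
theorem DRSubmodular.antitone_ray {E : Type*} [Fintype E] [DecidableEq E]
    {f : (E → ℤ) → ℝ} (hf : DRSubmodular f) {e : E} {x : E → ℤ}
    (hx : f (x + Pi.single e 1) ≤ f x) :
    Antitone fun n : ℕ => f (x + (n : ℤ) • Pi.single e 1) := by
  refine antitone_nat_of_succ_le fun n => ?_
  have hle : x ≤ x + (n : ℤ) • Pi.single e (1 : ℤ) :=
    le_add_of_nonneg_right (smul_nonneg (by positivity) (Pi.single_nonneg.2 zero_le_one))
  have h := hf _ _ hle e
  have hs : x + ((n + 1 : ℕ) : ℤ) • Pi.single e (1 : ℤ) =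
      x + (n : ℤ) • Pi.single e 1 + Pi.single e 1 := by
    push_cast
    rw [add_smul, one_smul, add_assoc]
  rw [hs]
  linarith

/-- If `f(-χ_e | y - (q-1)·χ_e) ≥ 0` and `1 ≤ p ≤ q`, then
`0 ≤ f(-p·χ_e | y) ≤ f(-q·χ_e | y)`. -/
theorem drSubmodular_marginal_monotone_neg {E : Type*} [Fintype E] [DecidableEq E]
    (f : (E → ℤ) → ℝ) (hf : DRSubmodular f) (e : E) (y : E → ℤ)
    (p q : ℤ) (hp : 1 ≤ p) (hpq : p ≤ q)
    (hq : 0 ≤ marginal f (-Pi.single e 1) (y - (q - 1) • Pi.single e 1)) :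
    0 ≤ marginal f (-(p • Pi.single e 1)) y ∧
      marginal f (-(p • Pi.single e 1)) y ≤ marginal f (-(q • Pi.single e 1)) y := by
  have hx : f (y - q • Pi.single e 1 + Pi.single e 1) ≤ f (y - q • Pi.single e 1) := by
    have h₁ : y - (q - 1) • Pi.single e (1 : ℤ) = y - q • Pi.single e 1 + Pi.single e 1 := by
      module
    have h₂ : y - q • Pi.single e (1 : ℤ) + Pi.single e 1 + -Pi.single e 1 =
        y - q • Pi.single e 1 := by
      abel
    rw [marginal, h₁, h₂] at hq
    linarith
  have hanti := hf.antitone_ray hx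
  obtain ⟨m, hm⟩ := Int.eq_ofNat_of_zero_le (sub_nonneg.2 hpq)
  obtain ⟨k, rfl⟩ := Int.eq_ofNat_of_zero_le (zero_le_one.trans (hp.trans hpq))
  obtain rfl : p = (k : ℤ) - m := by omega
  have h₀ := hanti (Nat.zero_le m)
  have h₁ := hanti (show m ≤ k by omega)
  have e₀ : y - (k : ℤ) • Pi.single e (1 : ℤ) + ((0 : ℕ) : ℤ) • Pi.single e 1 =
      y + -((k : ℤ) • Pi.single e 1) := by
    simp [sub_eq_add_neg]
  have e₁ : y - (k : ℤ) • Pi.single e (1 : ℤ) + (m : ℤ) • Pi.single e 1 =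
      y + -(((k : ℤ) - m) • Pi.single e 1) := by
    module
  have e₂ : y - (k : ℤ) • Pi.single e (1 : ℤ) + (k : ℤ) • Pi.single e 1 = y :=
    sub_add_cancel _ _
  simp only [e₀, e₁, e₂] at h₀ h₁
  constructor <;> simp only [marginal] <;> linarith
end

section
/- Every DR-submodular function f : (E → ℤ) → ℝ is lattice submodular: for all x, y : E → ℤ, f(x) + f(y) ≥ f(x ∨ y) + f(x ∧ y), where (x ∨ y)(e) = max{x(e), y(e)} and (x ∧ y)(e) = min{x(e), y(e)} for every e ∈ E. -/
/-- The displacements `d` along which the increments of `f` are antitone in the base point. -/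
def antitoneIncrements {E : Type*} (f : (E → ℤ) → ℝ) : AddSubmonoid (E → ℤ) where
  carrier := {d | ∀ x y : E → ℤ, x ≤ y → f (y + d) - f y ≤ f (x + d) - f x}
  zero_mem' := by simp
  add_mem' := by
    intro c d hc hd x y hxy
    have h₁ := hc x y hxy
    have h₂ := hd (x + c) (y + c) (add_le_add_left hxy c)
    rw [← add_assoc, ← add_assoc]
    linarith

theorem DRSubmodular.mem_antitoneIncrements {E : Type*} [Fintype E] [DecidableEq E]
    {f : (E → ℤ) → ℝ} (hf : DRSubmodular f) {d : E → ℤ} (hd : 0 ≤ d) :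
    d ∈ antitoneIncrements f := by
  have hsum : d = ∑ e, (d e).toNat • (Pi.single e 1 : E → ℤ) := by
    ext a
    simpa [Finset.sum_apply, Pi.single_apply] using hd a
  rw [hsum]
  have hsingle (e : E) : (Pi.single e 1 : E → ℤ) ∈ antitoneIncrements f :=
    fun x y hxy => hf x y hxy e
  exact sum_mem fun e _ => nsmul_mem (hsingle e) _

/-- Every DR-submodular function over the integer lattice is lattice submodular:
`f(x) + f(y) ≥ f(x ⊔ y) + f(x ⊓ y)`. -/
theorem drSubmodular_lattice_submodular {E : Type*} [Fintype E] [DecidableEq E]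
    (f : (E → ℤ) → ℝ) (hf : DRSubmodular f) :
    ∀ x y : E → ℤ, f x + f y ≥ f (x ⊔ y) + f (x ⊓ y) := by
  intro x y
  have h := hf.mem_antitoneIncrements (sub_nonneg.2 (inf_le_left : x ⊓ y ≤ x))
    (x ⊓ y) y inf_le_right
  have hsup : y + (x - x ⊓ y) = x ⊔ y := by
    ext e
    simp only [Pi.add_apply, Pi.sub_apply, Pi.inf_apply, Pi.sup_apply]
    omega
  rw [add_sub_cancel, hsup] at h
  linarith
end
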